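/- Let f : ℝⁿ → ℝ be an upper semicontinuous piecewise polynomial function. Then there exist m ∈ ℕ, polynomials P, Q : ℝⁿ × ℝᵐ → ℝ with Q(x,·) convex on ℝᵐ for every fixed x, and a bounded box 𝒴 = [a₁,b₁] × … × [aₘ,bₘ] ⊆ ℝᵐ (all aᵢ, bᵢ real), such that the pessimistic value function φ_p of the associated bilevel problem satisfies φ_p = f. -/

import Mathlib

open Set

noncomputable section

/-- The lower-level argmin set `Θ(x) = {y ∈ 𝒴 : ∀ y' ∈ 𝒴, Q(x,y) ≤ Q(x,y')}`. -/
def argminSet {n m : ℕ} (Q : (Fin n → ℝ) → (Fin m → ℝ) → ℝ) (Y : Set (Fin m → ℝ))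
    (x : Fin n → ℝ) : Set (Fin m → ℝ) :=
  {y | y ∈ Y ∧ ∀ y' ∈ Y, Q x y ≤ Q x y'}

/-- Optimistic value function `φ_o(x) = inf_{y ∈ Θ(x)} P(x,y)`,
with the convention `inf ∅ = +∞`. -/
def valOpt {n m : ℕ} (P Q : (Fin n → ℝ) → (Fin m → ℝ) → ℝ) (Y : Set (Fin m → ℝ))
    (x : Fin n → ℝ) : EReal :=
  ⨅ y ∈ argminSet Q Y x, ((P x y : ℝ) : EReal)

/-- Pessimistic value function `φ_p(x) = sup_{y ∈ Θ(x)} P(x,y)`,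
with the convention `sup ∅ = -∞`. -/
def valPess {n m : ℕ} (P Q : (Fin n → ℝ) → (Fin m → ℝ) → ℝ) (Y : Set (Fin m → ℝ))
    (x : Fin n → ℝ) : EReal :=
  ⨆ y ∈ argminSet Q Y x, ((P x y : ℝ) : EReal)

/-- `P (x, y)` is a real polynomial in the joint variables `(x, y)`. -/
def IsPolyMap {n m : ℕ} (P : (Fin n → ℝ) → (Fin m → ℝ) → ℝ) : Prop :=
  ∃ p : MvPolynomial (Fin n ⊕ Fin m) ℝ,
    ∀ x y, P x y = MvPolynomial.eval (Sum.elim x y) p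

/-- Basic semi-algebraic subset of `ℝ^ι`. -/
def IsBasicSemialgebraic {ι : Type} [Fintype ι] (S : Set (ι → ℝ)) : Prop :=
  ∃ (p : MvPolynomial ι ℝ) (k : ℕ) (q : Fin k → MvPolynomial ι ℝ),
    S = {x | MvPolynomial.eval x p = 0 ∧ ∀ j, 0 < MvPolynomial.eval x (q j)}

/-- Semi-algebraic set: a finite union of basic semi-algebraic sets. -/
def IsSemialgebraic {ι : Type} [Fintype ι] (S : Set (ι → ℝ)) : Prop :=
  ∃ (N : ℕ) (T : Fin N → Set (ι → ℝ)),
    (∀ i, IsBasicSemialgebraic (T i)) ∧ S = ⋃ i, T i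

/-- Semi-algebraic real-valued function: its graph (inside `ℝ^{ι} × ℝ ≅ ℝ^{ι ⊕ Unit}`)
is semi-algebraic. -/
def IsSemialgebraicFun {ι : Type} [Fintype ι] (f : (ι → ℝ) → ℝ) : Prop :=
  IsSemialgebraic {z : (ι ⊕ Unit) → ℝ | f (z ∘ Sum.inl) = z (Sum.inr ())}

/-- Extended-real-valued semi-algebraic function: the sets where it is finite, `+∞`, `-∞`
are semi-algebraic, and the graph of its restriction to its (finite) domain is
semi-algebraic. -/
def IsERealSemialgebraicFun {ι : Type} [Fintype ι] (h : (ι → ℝ) → EReal) : Prop :=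
  IsSemialgebraic {x | ∃ r : ℝ, h x = (r : EReal)} ∧
  IsSemialgebraic {x | h x = ⊤} ∧
  IsSemialgebraic {x | h x = ⊥} ∧
  IsSemialgebraic {z : (ι ⊕ Unit) → ℝ | h (z ∘ Sum.inl) = ((z (Sum.inr ()) : ℝ) : EReal)}

/-- A (possibly unbounded) box `[a₁,b₁] × ⋯ × [aₘ,bₘ]` in `ℝ^m`, with
endpoints in `ℝ ∪ {±∞}`. -/
def IsBox {m : ℕ} (Y : Set (Fin m → ℝ)) : Prop :=
  ∃ a b : Fin m → EReal,
    Y = {y | ∀ i, a i ≤ (y i : EReal) ∧ (y i : EReal) ≤ b i}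

/-- The bounded box `[a₁,b₁] × ⋯ × [aₘ,bₘ]` with real endpoints. -/
def boundedBox {m : ℕ} (a b : Fin m → ℝ) : Set (Fin m → ℝ) :=
  {y | ∀ i, y i ∈ Set.Icc (a i) (b i)}

/-- Piecewise polynomial function: there is a finite partition of `ℝ^n` into pairwise
disjoint semi-algebraic sets on each of which `f` coincides with a polynomial. -/
def IsPiecewisePolynomial {n : ℕ} (f : (Fin n → ℝ) → ℝ) : Prop :=
  ∃ (N : ℕ) (S : Fin N → Set (Fin n → ℝ)) (p : Fin N → MvPolynomial (Fin n) ℝ),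
    (∀ i, IsSemialgebraic (S i)) ∧
    (∀ i j, i ≠ j → Disjoint (S i) (S j)) ∧
    (⋃ i, S i) = Set.univ ∧
    (∀ i, ∀ x ∈ S i, f x = MvPolynomial.eval x (p i))

/-- The piecewise linear map moving `c` to `d` inside `[a, b]`. -/
def moveFun (a b c d x : ℝ) : ℝ :=
  if x ≤ a then x
  else if x ≤ c then a + (x - a) * ((d - a) / (c - a))
  else if x ≤ b then b - (b - x) * ((b - d) / (b - c))
  else x

theorem moveFun_strictMono {a b c d : ℝ} (hac : a < c) (hcb : c < b) (had : a < d) (hdb : d < b) :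
    StrictMono (moveFun a b c d) := by
  have h1 : 0 < (d - a) / (c - a) := div_pos (by linarith) (by linarith)
  have h2 : 0 < (b - d) / (b - c) := div_pos (by linarith) (by linarith)
  have e1 : (c - a) * ((d - a) / (c - a)) = d - a := mul_div_cancel₀ _ (by linarith)
  have e2 : (b - c) * ((b - d) / (b - c)) = b - d := mul_div_cancel₀ _ (by linarith)
  set r := (d - a) / (c - a)
  set s := (b - d) / (b - c)
  intro x y hxy
  unfold moveFun
  split_ifs <;> nlinarith

theorem moveFun_rightInverse {a b c d : ℝ} (hac : a < c) (hcb : c < b) (had : a < d)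
    (hdb : d < b) : Function.RightInverse (moveFun a b d c) (moveFun a b c d) := by
  intro x
  have h1 : 0 < (c - a) / (d - a) := div_pos (by linarith) (by linarith)
  have h2 : 0 < (b - c) / (b - d) := div_pos (by linarith) (by linarith)
  have e1 : (d - a) * ((c - a) / (d - a)) = c - a := mul_div_cancel₀ _ (by linarith)
  have e2 : (b - d) * ((b - c) / (b - d)) = b - c := mul_div_cancel₀ _ (by linarith)
  have e3 : (c - a) / (d - a) * ((d - a) / (c - a)) = 1 := by
    have : c - a ≠ 0 := by linarith
    have : d - a ≠ 0 := by linarith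
    field_simp
  have e4 : (b - c) / (b - d) * ((b - d) / (b - c)) = 1 := by
    have : b - c ≠ 0 := by linarith
    have : b - d ≠ 0 := by linarith
    field_simp
  set r := (c - a) / (d - a)
  set s := (b - c) / (b - d)
  set r' := (d - a) / (c - a)
  set s' := (b - d) / (b - c)
  rcases le_or_gt x a with hxa | hxa
  · simp [moveFun, hxa]
  rcases le_or_gt x d with hxd | hxd
  · have : moveFun a b d c x = a + (x - a) * r := by
      simp [moveFun, not_le.2 hxa, hxd, r]
    rw [this]
    have h3 : ¬ a + (x - a) * r ≤ a := by nlinarith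
    have h4 : a + (x - a) * r ≤ c := by nlinarith
    simp only [moveFun, h3, h4, if_true, if_false]
    linear_combination (x - a) * e3
  rcases le_or_gt x b with hxb | hxb
  · have : moveFun a b d c x = b - (b - x) * s := by
      simp [moveFun, not_le.2 hxa, not_le.2 hxd, hxb, s]
    rw [this]
    have h3 : ¬ b - (b - x) * s ≤ a := by nlinarith
    have h4 : ¬ b - (b - x) * s ≤ c := by nlinarith
    have h5 : b - (b - x) * s ≤ b := by nlinarith
    simp only [moveFun, h3, h4, h5, if_true, if_false]
    linear_combination -(b - x) * e4
  · have h3 : ¬ x ≤ c := by linarith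
    simp [moveFun, not_le.2 hxa, not_le.2 hxd, not_le.2 hxb, h3]

theorem exists_orderIso_move {a b c d : ℝ} (hac : a < c) (hcb : c < b) (had : a < d)
    (hdb : d < b) : ∃ θ : ℝ ≃o ℝ, θ c = d ∧ ∀ x, x ∉ Ioo a b → θ x = x := by
  refine ⟨(moveFun_strictMono hac hcb had hdb).orderIsoOfRightInverse _ _
    (moveFun_rightInverse hac hcb had hdb), ?_, fun x hx => ?_⟩
  · have : (c - a) * ((d - a) / (c - a)) = d - a := mul_div_cancel₀ _ (by linarith)
    simp [moveFun, not_le.2 hac, this]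
  · rcases le_or_gt x a with hxa | hxa
    · simp [moveFun, hxa]
    · have hbx : b ≤ x := by
        by_contra h
        exact hx ⟨hxa, not_le.1 h⟩
      rcases hbx.eq_or_lt with rfl | hbx
      · simp [moveFun, not_le.2 hxa, not_le.2 hcb]
      · simp [moveFun, not_le.2 hxa, not_le.2 hbx, not_le.2 (hcb.trans hbx)]

theorem exists_bracket (Z : Finset ℝ) {x l r : ℝ} (hl : l ∈ Z) (hr : r ∈ Z)
    (hlx : l < x) (hxr : x < r) (hx : x ∉ Z) :
    ∃ a ∈ Z, ∃ b ∈ Z, a < x ∧ x < b ∧ ∀ z ∈ Z, z ∉ Ioo a b := by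
  classical
  obtain ⟨a, ha, hamax⟩ := (Z.filter (· < x)).exists_max_image id ⟨l, by simp [hl, hlx]⟩
  obtain ⟨b, hb, hbmin⟩ := (Z.filter (x < ·)).exists_min_image id ⟨r, by simp [hr, hxr]⟩
  simp only [Finset.mem_filter, id] at ha hb hamax hbmin
  refine ⟨a, ha.1, b, hb.1, ha.2, hb.2, fun z hz hzab => ?_⟩
  rcases lt_trichotomy z x with h | h | h
  · exact absurd (hamax z ⟨hz, h⟩) (not_le.2 hzab.1)
  · exact hx (h ▸ hz)
  · exact absurd (hbmin z ⟨hz, h⟩) (not_le.2 hzab.2)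

/-- A zero of `f` between consecutive points of agreement yields one of `g`. -/
theorem exists_zero_of_sign_eq {f g : ℝ → ℝ} (hg : Continuous g) {a b c : ℝ}
    (hac : a < c) (hcb : c < b) (ha : SignType.sign (f a) = SignType.sign (g a))
    (hb : SignType.sign (f b) = SignType.sign (g b))
    (hm : StrictMonoOn f (Icc a b)) (hc : f c = 0) : ∃ d ∈ Ioo a b, g d = 0 := by
  have h1 : f a < 0 := hc ▸ hm ⟨le_rfl, (hac.trans hcb).le⟩ ⟨hac.le, hcb.le⟩ hac
  have h2 : 0 < f b := hc ▸ hm ⟨hac.le, hcb.le⟩ ⟨(hac.trans hcb).le, le_rfl⟩ hcb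
  rw [sign_neg h1, eq_comm, sign_eq_neg_one_iff] at ha
  rw [sign_pos h2, eq_comm, sign_eq_one_iff] at hb
  exact intermediate_value_Ioo (hac.trans hcb).le hg.continuousOn ⟨ha, hb⟩

theorem sign_eq_of_strictMonoOn {f g : ℝ → ℝ} (hf : Continuous f) {a b x : ℝ} (θ : ℝ ≃o ℝ)
    (hax : a < x) (hxb : x < b) (ha : SignType.sign (f a) = SignType.sign (g a))
    (hb : SignType.sign (f b) = SignType.sign (g b)) (hθa : θ a = a) (hθb : θ b = b)
    (hm : StrictMonoOn g (Icc a b)) (hz : ∀ c, f c = 0 → g (θ c) = 0) :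
    SignType.sign (f x) = SignType.sign (g (θ x)) := by
  have hmem : ∀ y ∈ Icc a b, θ y ∈ Icc a b := fun y hy =>
    ⟨hθa ▸ θ.monotone hy.1, hθb ▸ θ.monotone hy.2⟩
  have hab := hax.trans hxb
  rcases lt_trichotomy (f x) 0 with h | h | h
  · rw [sign_neg h, eq_comm, sign_eq_neg_one_iff]
    suffices ∃ c ∈ Ioc x b, g (θ c) ≤ 0 by
      obtain ⟨c, hc, hgc⟩ := this
      exact (hm (hmem x ⟨hax.le, hxb.le⟩) (hmem c ⟨(hax.trans hc.1).le, hc.2⟩)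
        (θ.strictMono hc.1)).trans_le hgc
    rcases lt_or_ge (f b) 0 with hfb | hfb
    · refine ⟨b, ⟨hxb, le_rfl⟩, ?_⟩
      rw [sign_neg hfb, eq_comm, sign_eq_neg_one_iff] at hb
      rw [hθb]; exact hb.le
    · obtain ⟨c, hc, hfc⟩ := intermediate_value_Ioc hxb.le hf.continuousOn ⟨h, hfb⟩
      exact ⟨c, hc, (hz c hfc).le⟩
  · rw [h, hz x h]
  · rw [sign_pos h, eq_comm, sign_eq_one_iff]
    suffices ∃ c ∈ Ico a x, 0 ≤ g (θ c) by
      obtain ⟨c, hc, hgc⟩ := this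
      exact hgc.trans_lt (hm (hmem c ⟨hc.1, (hc.2.trans hxb).le⟩) (hmem x ⟨hax.le, hxb.le⟩)
        (θ.strictMono hc.2))
    rcases lt_or_ge 0 (f a) with hfa | hfa
    · refine ⟨a, ⟨le_rfl, hax⟩, ?_⟩
      rw [sign_pos hfa, eq_comm, sign_eq_one_iff] at ha
      rw [hθa]; exact ha.le
    · obtain ⟨c, hc, hfc⟩ := intermediate_value_Ico hax.le hf.continuousOn ⟨hfa, h⟩
      exact ⟨c, hc, (hz c hfc).ge⟩

theorem sign_neg_congr {a b : ℝ} (h : SignType.sign a = SignType.sign b) :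
    SignType.sign (-a) = SignType.sign (-b) := by
  rw [Left.sign_neg, Left.sign_neg, h]

/-- Two continuous functions with the same monotonicity between consecutive points of `Z` and the
same signs on `Z` and at infinity have the same signs up to reparametrization. -/
theorem exists_orderIso_sign_eq {f g : ℝ → ℝ} (hf : Continuous f) (hg : Continuous g)
    (Z : Finset ℝ) (hZ : ∀ z ∈ Z, SignType.sign (f z) = SignType.sign (g z))
    (hmono : ∀ a b, (∀ z ∈ Z, z ∉ Ioo a b) →
      (StrictMonoOn f (Icc a b) ∧ StrictMonoOn g (Icc a b)) ∨
      (StrictAntiOn f (Icc a b) ∧ StrictAntiOn g (Icc a b)))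
    (hbot : ∃ s, ∀ᶠ x in Filter.atBot, SignType.sign (f x) = s ∧ SignType.sign (g x) = s)
    (htop : ∃ s, ∀ᶠ x in Filter.atTop, SignType.sign (f x) = s ∧ SignType.sign (g x) = s)
    (hfin : {x | f x = 0}.Finite) :
    ∃ θ : ℝ ≃o ℝ, (∀ z ∈ Z, θ z = z) ∧ ∀ x, SignType.sign (f x) = SignType.sign (g (θ x)) := by
  classical
  obtain ⟨s, hs⟩ := hbot
  obtain ⟨s', hs'⟩ := htop
  obtain ⟨L, hL⟩ := Filter.eventually_atBot.1 hs
  obtain ⟨R, hR⟩ := Filter.eventually_atTop.1 hs'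
  set W : Finset ℝ := insert L (insert R Z) with hW
  have hLW : L ∈ W := by simp [hW]
  have hRW : R ∈ W := by simp [hW]
  have hWs : ∀ z ∈ W, SignType.sign (f z) = SignType.sign (g z) := by
    intro z hz
    simp only [hW, Finset.mem_insert] at hz
    rcases hz with rfl | rfl | hz
    · rw [(hL _ le_rfl).1, (hL _ le_rfl).2]
    · rw [(hR _ le_rfl).1, (hR _ le_rfl).2]
    · exact hZ z hz
  have hWm : ∀ a b, (∀ z ∈ W, z ∉ Ioo a b) →
      (StrictMonoOn f (Icc a b) ∧ StrictMonoOn g (Icc a b)) ∨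
      (StrictAntiOn f (Icc a b) ∧ StrictAntiOn g (Icc a b)) :=
    fun a b h => hmono a b fun z hz => h z (by simp [hW, hz])
  have hout : ∀ θ : ℝ ≃o ℝ, (∀ z ∈ W, θ z = z) → ∀ x, ¬ (L < x ∧ x < R ∧ x ∉ W) →
      SignType.sign (f x) = SignType.sign (g (θ x)) := by
    intro θ hθ x hx
    by_cases hxW : x ∈ W
    · rw [hθ x hxW, hWs x hxW]
    rcases le_or_gt x L with h | h
    · rw [(hL x h).1, (hL _ (by rw [← hθ L hLW]; exact θ.monotone h)).2]
    rcases le_or_gt R x with h' | h'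
    · rw [(hR x h').1, (hR _ (by simpa [hθ R hRW] using θ.monotone h')).2]
    exact absurd ⟨h, h', hxW⟩ hx
  have key : ∀ C : Finset ℝ, (∀ c ∈ C, f c = 0) →
      ∃ θ : ℝ ≃o ℝ, (∀ z ∈ W, θ z = z) ∧ ∀ c ∈ C, g (θ c) = 0 := by
    intro C
    induction C using Finset.induction_on with
    | empty => exact fun _ => ⟨OrderIso.refl ℝ, by simp, by simp⟩
    | insert c C hcC ih =>
      intro hC
      obtain ⟨θ, hθ, hθC⟩ := ih fun c hc => hC c (Finset.mem_insert_of_mem hc)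
      have hfc := hC c (Finset.mem_insert_self _ _)
      by_cases hgc : g (θ c) = 0
      · exact ⟨θ, hθ, by simpa [hgc] using hθC⟩
      have hcin : L < c ∧ c < R ∧ c ∉ W := by
        by_contra h
        have := hout θ hθ c h
        rw [hfc, sign_zero, eq_comm, sign_eq_zero_iff] at this
        exact hgc this
      obtain ⟨a, ha, b, hb, hac, hcb, hab⟩ :=
        exists_bracket W hLW hRW hcin.1 hcin.2.1 hcin.2.2
      have hθab : ∀ y, θ y ∈ Ioo a b ↔ y ∈ Ioo a b := by
        intro y
        conv_lhs => rw [← hθ a ha, ← hθ b hb]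
        simp
      obtain ⟨d, hd, hgd⟩ : ∃ d ∈ Ioo a b, g d = 0 := by
        rcases hWm a b hab with h | h
        · exact exists_zero_of_sign_eq hg hac hcb (hWs a ha) (hWs b hb) h.1 hfc
        · obtain ⟨d, hd, hgd⟩ := exists_zero_of_sign_eq (f := fun x => - f x) (g := fun x => - g x)
            hg.neg hac hcb (sign_neg_congr (hWs a ha)) (sign_neg_congr (hWs b hb)) h.1.neg
            (by simp [hfc])
          exact ⟨d, hd, by simpa using hgd⟩
      have hcab := (hθab c).2 ⟨hac, hcb⟩
      obtain ⟨τ, hτ, hτ'⟩ := exists_orderIso_move hcab.1 hcab.2 hd.1 hd.2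
      refine ⟨θ.trans τ, fun z hz => ?_, fun e he => ?_⟩
      · rw [OrderIso.trans_apply, hθ z hz, hτ' z (hab z hz)]
      rw [Finset.mem_insert] at he
      rw [OrderIso.trans_apply]
      rcases he with rfl | he
      · rw [hτ, hgd]
      · rw [hτ' _ fun hmem => ?_, hθC e he]
        have heab := (hθab e).1 hmem
        have hec : e = c := by
          have hfe := hC e (Finset.mem_insert_of_mem he)
          rcases hWm a b hab with h | h
          · exact h.1.injOn ⟨heab.1.le, heab.2.le⟩ ⟨hac.le, hcb.le⟩ (hfe.trans hfc.symm)
          · exact h.1.injOn ⟨heab.1.le, heab.2.le⟩ ⟨hac.le, hcb.le⟩ (hfe.trans hfc.symm)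
        exact hcC (hec ▸ he)
  obtain ⟨θ, hθ, hθz⟩ := key hfin.toFinset (by simp)
  simp only [Finite.mem_toFinset, mem_ofPred_eq] at hθz
  refine ⟨θ, fun z hz => hθ z (by simp [hW, hz]), fun x => ?_⟩
  by_cases hx : L < x ∧ x < R ∧ x ∉ W
  · obtain ⟨a, ha, b, hb, hax, hxb, hab⟩ := exists_bracket W hLW hRW hx.1 hx.2.1 hx.2.2
    rcases hWm a b hab with h | h
    · exact sign_eq_of_strictMonoOn hf θ hax hxb (hWs a ha) (hWs b hb) (hθ a ha) (hθ b hb) h.2 hθz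
    · have := sign_eq_of_strictMonoOn (f := fun x => - f x) (g := fun x => - g x) hf.neg θ hax hxb
        (sign_neg_congr (hWs a ha)) (sign_neg_congr (hWs b hb)) (hθ a ha) (hθ b hb) h.2.neg
        (by simpa using hθz)
      simpa using sign_neg_congr this
  · exact hout θ hθ x hx

open Polynomial in
theorem exists_pseudo_remainder {R : Type*} [CommRing R] (p q : R[X]) (hq : 0 < q.natDegree) :
    ∃ (k : ℕ) (a r : R[X]), r.natDegree < q.natDegree ∧ C q.leadingCoeff ^ k * p = a * q + r := by
  induction hn : p.natDegree using Nat.strong_induction_on generalizing p with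
  | _ n ih =>
    rcases lt_or_ge p.natDegree q.natDegree with h | h
    · exact ⟨0, 0, p, h, by simp⟩
    set p₁ := C q.leadingCoeff * p - C p.leadingCoeff * X ^ (p.natDegree - q.natDegree) * q with hp₁
    have hdeg : p₁.natDegree ≤ n - 1 := by
      rw [natDegree_le_iff_coeff_eq_zero]
      intro N hN
      have hN' : n ≤ N := by omega
      rw [hp₁, coeff_sub, coeff_C_mul, mul_assoc, coeff_C_mul, coeff_X_pow_mul',
        if_pos (by omega)]
      rcases hN'.eq_or_lt with rfl | hlt
      · rw [← hn, Nat.sub_sub_self h]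
        rw [coeff_natDegree, coeff_natDegree, mul_comm, sub_self]
      · rw [coeff_eq_zero_of_natDegree_lt (by omega), coeff_eq_zero_of_natDegree_lt (by omega)]
        simp
    obtain ⟨k, a, r, hr, e⟩ := ih p₁.natDegree (by omega) p₁ rfl
    refine ⟨k + 1, a + C q.leadingCoeff ^ k * (C p.leadingCoeff *
      X ^ (p.natDegree - q.natDegree)), r, hr, ?_⟩
    rw [hp₁] at e
    linear_combination e

theorem pos_or_neg_of_ne_zero {h : ℝ → ℝ} (hc : Continuous h) {a b : ℝ}
    (h0 : ∀ x ∈ Ioo a b, h x ≠ 0) : (∀ x ∈ Ioo a b, 0 < h x) ∨ ∀ x ∈ Ioo a b, h x < 0 := by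
  by_contra! H
  obtain ⟨⟨x, hx, hx'⟩, y, hy, hy'⟩ := H
  obtain ⟨z, hz, hz'⟩ := isPreconnected_Ioo.intermediate_value hx hy hc.continuousOn ⟨hx', hy'⟩
  exact h0 z hz hz'

theorem eventually_sign_eq_of_isEquivalent {l : Filter ℝ} {f g : ℝ → ℝ}
    (h : Asymptotics.IsEquivalent l f g) :
    ∀ᶠ x in l, SignType.sign (f x) = SignType.sign (g x) := by
  obtain ⟨r, hr, hfg⟩ := h.exists_eq_mul
  filter_upwards [hfg, hr.eventually (lt_mem_nhds zero_lt_one)] with x hx hx'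
  rw [hx, Pi.mul_apply, sign_mul, sign_pos hx', one_mul]

section Elimination

open Polynomial

variable {R : Type*} [CommRing R]

/-- The reparametrization `φ` of the line matches the signs of the polynomials in `F`, specialized
along `u`, with those of the same polynomials specialized along `v`. -/
def SignMatch (u v : R →+* ℝ) (F : Finset R[X]) (φ : ℝ ≃o ℝ) : Prop :=
  ∀ q ∈ F, ∀ x, SignType.sign ((q.map u).eval x) = SignType.sign ((q.map v).eval (φ x))

theorem sign_at_bot_top (p : ℝ[X]) :
    (∀ᶠ x in Filter.atTop, SignType.sign (p.eval x) = SignType.sign p.leadingCoeff) ∧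
    (∀ᶠ x in Filter.atBot, SignType.sign (p.eval x) =
      SignType.sign p.leadingCoeff * (-1) ^ p.natDegree) := by
  constructor
  · filter_upwards [eventually_sign_eq_of_isEquivalent p.isEquivalent_atTop_lead,
      Filter.eventually_gt_atTop 0] with x hx hx0
    rw [hx, sign_mul, sign_pow, sign_pos hx0, one_pow, mul_one]
  · filter_upwards [eventually_sign_eq_of_isEquivalent p.isEquivalent_atBot_lead,
      Filter.eventually_lt_atBot 0] with x hx hx0
    simp only [hx, sign_mul, sign_pow, sign_neg hx0]

theorem exists_signMatch_insert [DecidableEq R[X]] {u v : R →+* ℝ} {F : Finset R[X]} {p : R[X]}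
    {φ : ℝ ≃o ℝ} (hφ : SignMatch u v F φ) (hd : 0 < p.natDegree)
    (hlc : SignType.sign (u p.leadingCoeff) = SignType.sign (v p.leadingCoeff))
    (hlc0 : u p.leadingCoeff ≠ 0) (hder : derivative p ∈ F)
    (hz : ∀ q ∈ F, q.map u ≠ 0 → ∀ x, (q.map u).eval x = 0 →
      SignType.sign ((p.map u).eval x) = SignType.sign ((p.map v).eval (φ x))) :
    ∃ ψ, SignMatch u v (insert p F) ψ := by
  classical
  have hlc0' : v p.leadingCoeff ≠ 0 := by
    rwa [← sign_ne_zero, ← hlc, sign_ne_zero]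
  have hnu := natDegree_map_of_leadingCoeff_ne_zero u hlc0
  have hnv := natDegree_map_of_leadingCoeff_ne_zero v hlc0'
  have hlu := leadingCoeff_map_of_leadingCoeff_ne_zero u hlc0
  have hlv := leadingCoeff_map_of_leadingCoeff_ne_zero v hlc0'
  have hpu : p.map u ≠ 0 := by
    intro h; rw [h] at hnu; simp at hnu; omega
  have hdu : (derivative p).map u ≠ 0 := by
    rw [← derivative_map]
    intro h
    have := derivative_eq_zero.1 h
    omega
  set Z : Finset ℝ := F.biUnion fun q => (q.map u).roots.toFinset with hZ
  have hmem : ∀ q ∈ F, q.map u ≠ 0 → ∀ x, (q.map u).eval x = 0 → x ∈ Z := by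
    intro q hq hq0 x hx
    rw [hZ, Finset.mem_biUnion]
    exact ⟨q, hq, by simp [hq0, hx]⟩
  obtain ⟨θ, hθZ, hθ⟩ : ∃ θ : ℝ ≃o ℝ, (∀ z ∈ Z, θ z = z) ∧ ∀ x,
      SignType.sign ((p.map u).eval x) = SignType.sign ((p.map v).eval (φ (θ x))) := by
    refine exists_orderIso_sign_eq (f := fun x => (p.map u).eval x)
      (g := fun x => (p.map v).eval (φ x)) (p.map u).continuous
      ((p.map v).continuous.comp φ.continuous) Z ?_ ?_ ?_ ?_ ?_
    · intro z hzZ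
      simp only [hZ, Finset.mem_biUnion, Multiset.mem_toFinset, mem_roots', IsRoot.def] at hzZ
      obtain ⟨q, hq, hq0, hqz⟩ := hzZ
      exact hz q hq hq0 z hqz
    · intro a b hab
      have hmaps : MapsTo φ (Icc a b) (Icc (φ a) (φ b)) :=
        fun x hx => ⟨φ.monotone hx.1, φ.monotone hx.2⟩
      have hder' : ∀ y ∈ Ioo (φ a) (φ b), ∃ x ∈ Ioo a b,
          SignType.sign (((derivative p).map u).eval x) =
            SignType.sign (((derivative p).map v).eval y) := by
        intro y hy
        refine ⟨φ.symm y, ⟨φ.lt_symm_apply.2 hy.1, φ.symm_apply_lt.2 hy.2⟩, ?_⟩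
        rw [hφ _ hder, φ.apply_symm_apply]
      rcases pos_or_neg_of_ne_zero ((derivative p).map u).continuous
        (fun x hx h0 => hab x (hmem _ hder hdu x h0) hx) with h | h
      · left
        refine ⟨strictMonoOn_of_deriv_pos (convex_Icc a b) (p.map u).continuous.continuousOn ?_, ?_⟩
        · intro x hx
          rw [interior_Icc] at hx
          rw [Polynomial.deriv, derivative_map]
          exact h x hx
        · refine StrictMonoOn.comp (g := fun y => (p.map v).eval y) ?_
            (φ.strictMono.strictMonoOn _) hmaps
          refine strictMonoOn_of_deriv_pos (convex_Icc _ _) (p.map v).continuous.continuousOn ?_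
          intro y hy
          rw [interior_Icc] at hy
          rw [Polynomial.deriv, derivative_map]
          obtain ⟨x, hx, e⟩ := hder' y hy
          rwa [sign_pos (h x hx), eq_comm, sign_eq_one_iff] at e
      · right
        refine ⟨strictAntiOn_of_deriv_neg (convex_Icc a b) (p.map u).continuous.continuousOn ?_, ?_⟩
        · intro x hx
          rw [interior_Icc] at hx
          rw [Polynomial.deriv, derivative_map]
          exact h x hx
        · refine StrictAntiOn.comp_strictMonoOn (g := fun y => (p.map v).eval y) ?_
            (φ.strictMono.strictMonoOn _) hmaps
          refine strictAntiOn_of_deriv_neg (convex_Icc _ _) (p.map v).continuous.continuousOn ?_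
          intro y hy
          rw [interior_Icc] at hy
          rw [Polynomial.deriv, derivative_map]
          obtain ⟨x, hx, e⟩ := hder' y hy
          rwa [sign_neg (h x hx), eq_comm, sign_eq_neg_one_iff] at e
    · refine ⟨_, (sign_at_bot_top (p.map u)).2.and ?_⟩
      have := φ.tendsto_atBot.eventually (sign_at_bot_top (p.map v)).2
      rw [hlv, ← hlc, hnv] at this
      rw [hlu, hnu]
      exact this
    · refine ⟨_, (sign_at_bot_top (p.map u)).1.and ?_⟩
      have := φ.tendsto_atTop.eventually (sign_at_bot_top (p.map v)).1
      rw [hlv, ← hlc] at this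
      rw [hlu]
      exact this
    · refine (p.map u).roots.toFinset.finite_toSet.subset fun x hx => ?_
      simpa [hpu] using hx
  refine ⟨θ.trans φ, fun q hq x => ?_⟩
  rw [OrderIso.trans_apply]
  rcases Finset.mem_insert.1 hq with rfl | hq
  · exact hθ x
  rw [← hφ q hq]
  by_cases hq0 : q.map u = 0
  · simp [hq0]
  by_cases hx : (q.map u).eval x = 0
  · rw [hθZ x (hmem q hq hq0 x hx)]
  have hxθ : ∀ y ∈ uIcc x (θ x), (q.map u).eval y ≠ 0 := by
    intro y hy hqy
    have hyZ := hθZ y (hmem q hq hq0 y hqy)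
    have hxy : x ≠ y := fun h => hx (h ▸ hqy)
    rcases mem_uIcc.1 hy with h | h
    · have := θ.strictMono (h.1.lt_of_ne hxy)
      rw [hyZ] at this
      exact absurd h.2 (not_le.2 this)
    · have := θ.strictMono (h.2.lt_of_ne hxy.symm)
      rw [hyZ] at this
      exact absurd h.1 (not_le.2 this)
  by_contra hne
  have hprod : (q.map u).eval x * (q.map u).eval (θ x) < 0 := by
    rcases lt_or_gt_of_ne (hxθ x left_mem_uIcc) with h | h <;>
    rcases lt_or_gt_of_ne (hxθ _ right_mem_uIcc) with h' | h'
    · simp [sign_neg h, sign_neg h'] at hne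
    · exact mul_neg_of_neg_of_pos h h'
    · exact mul_neg_of_pos_of_neg h h'
    · simp [sign_pos h, sign_pos h'] at hne
  have hmem0 : (0 : ℝ) ∈ uIcc ((q.map u).eval x) ((q.map u).eval (θ x)) := by
    rw [mem_uIcc]
    rcases mul_neg_iff.1 hprod with h | h
    · exact Or.inr ⟨h.2.le, h.1.le⟩
    · exact Or.inl ⟨h.1.le, h.2.le⟩
  obtain ⟨y, hy, hy0⟩ := intermediate_value_uIcc (q.map u).continuous.continuousOn hmem0
  exact hxθ y hy hy0

theorem exists_eraseLead_closed [DecidableEq R[X]] (S : Finset R[X]) : ∃ T : Finset R[X], S ⊆ T ∧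
    (∀ q ∈ T, q.eraseLead ∈ T) ∧
    ∀ q ∈ T, q ∈ S ∨ ∃ s ∈ S, q.natDegree ≤ s.natDegree - 1 := by
  refine ⟨S.biUnion fun s => (Finset.range (s.support.card + 1)).image (eraseLead^[·] s),
    ?_, ?_, ?_⟩
  · intro s hs
    simp only [Finset.mem_biUnion, Finset.mem_image, Finset.mem_range]
    exact ⟨s, hs, 0, by omega, rfl⟩
  · intro q hq
    simp only [Finset.mem_biUnion, Finset.mem_image, Finset.mem_range] at hq ⊢
    obtain ⟨s, hs, j, hj, rfl⟩ := hq
    have hcard : ∀ i, (eraseLead^[i] s).support.card = s.support.card - i := by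
      intro i
      induction i with
      | zero => rfl
      | succ i ih => rw [Function.iterate_succ_apply', card_support_eraseLead, ih]; omega
    rcases Nat.lt_succ_iff_lt_or_eq.1 hj with h | h
    · exact ⟨s, hs, j + 1, by omega, Function.iterate_succ_apply' _ _ _⟩
    · refine ⟨s, hs, j, hj, ?_⟩
      have : eraseLead^[j] s = 0 := by
        rw [← card_support_eq_zero, hcard]; omega
      rw [this, eraseLead_zero]
  · intro q hq
    simp only [Finset.mem_biUnion, Finset.mem_image, Finset.mem_range] at hq
    obtain ⟨s, hs, j, hj, rfl⟩ := hq
    rcases j with _ | j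
    · exact Or.inl hs
    · refine Or.inr ⟨s, hs, ?_⟩
      clear hj
      induction j with
      | zero => exact eraseLead_natDegree_le s
      | succ j ih =>
        rw [Function.iterate_succ_apply']
        exact (eraseLead_natDegree_le _).trans (by omega)

theorem map_eraseLead_of_leadingCoeff_eq_zero {u : R →+* ℝ} {q : R[X]}
    (h : u q.leadingCoeff = 0) : q.eraseLead.map u = q.map u := by
  have := congrArg (Polynomial.map u) q.eraseLead_add_C_mul_X_pow
  simpa only [Polynomial.map_add, Polynomial.map_mul, map_C, h, C_0, zero_mul, add_zero] using this

theorem exists_truncation {T : Finset R[X]} (hT : ∀ q ∈ T, q.eraseLead ∈ T) (u : R →+* ℝ)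
    {q : R[X]} (hq : q ∈ T) (hq0 : q.map u ≠ 0) :
    ∃ q' ∈ T, q'.map u = q.map u ∧ u q'.leadingCoeff ≠ 0 := by
  induction hn : q.support.card using Nat.strong_induction_on generalizing q with
  | _ n ih =>
    by_cases h : u q.leadingCoeff = 0
    · have e := map_eraseLead_of_leadingCoeff_eq_zero h
      have hqne : q ≠ 0 := by rintro rfl; simp at hq0
      obtain ⟨q', h1, h2, h3⟩ := ih q.eraseLead.support.card
        (by have := card_support_eraseLead_add_one hqne; omega) (hT q hq) (e ▸ hq0) rfl
      exact ⟨q', h1, h2.trans e, h3⟩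
    · exact ⟨q, hq, rfl, h⟩

/-- The sign diagram of a finite family of univariate polynomials with parameters is determined by
the signs of finitely many expressions in the parameters. -/
theorem exists_sign_determining (F : Finset R[X]) : ∃ Q : Finset R, ∀ u v : R →+* ℝ,
    (∀ c ∈ Q, SignType.sign (u c) = SignType.sign (v c)) → ∃ φ, SignMatch u v F φ := by
  classical
  suffices H : ∀ d : ℕ, ∀ k : ℕ, ∀ F : Finset R[X], (∀ q ∈ F, q.natDegree ≤ d) →
      (F.filter (·.natDegree = d)).card ≤ k → ∃ Q : Finset R, ∀ u v : R →+* ℝ,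
      (∀ c ∈ Q, SignType.sign (u c) = SignType.sign (v c)) → ∃ φ, SignMatch u v F φ from
    H (F.sup natDegree) _ F (fun q hq => Finset.le_sup (f := natDegree) hq) le_rfl
  intro d
  induction d with
  | zero =>
    intro k F hF _
    refine ⟨F.image (·.coeff 0), fun u v huv => ⟨OrderIso.refl ℝ, fun q hq x => ?_⟩⟩
    have := huv _ (Finset.mem_image_of_mem _ hq)
    rw [eq_C_of_natDegree_le_zero (hF q hq)]
    simpa using this
  | succ d ihd =>
    intro k
    induction k with
    | zero =>
      intro F hF hk
      rw [Nat.le_zero, Finset.card_eq_zero, Finset.filter_eq_empty_iff] at hk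
      exact ihd _ F (fun q hq => Nat.le_of_lt_succ ((hF q hq).lt_of_ne (hk hq))) le_rfl
    | succ k ihk =>
      intro F hF hk
      rcases (F.filter (·.natDegree = d + 1)).eq_empty_or_nonempty with hne | ⟨p, hp⟩
      · exact ihk F hF (by simp [hne])
      rw [Finset.mem_filter] at hp
      obtain ⟨hpF, hpd⟩ := hp
      obtain ⟨T, hST, hTe, hTd⟩ := exists_eraseLead_closed (insert (derivative p) (F.erase p))
      have hpd' : (derivative p).natDegree ≤ d := by
        have := natDegree_derivative_le p; omega
      have hTF : ∀ q ∈ T, q.natDegree ≤ d ∨ q ∈ F.erase p := by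
        intro q hq
        rcases hTd q hq with h | ⟨s, hs, h⟩
        · rcases Finset.mem_insert.1 h with rfl | h
          · exact Or.inl hpd'
          · exact Or.inr h
        · left
          rcases Finset.mem_insert.1 hs with rfl | hs
          · omega
          · have := hF s (Finset.mem_of_mem_erase hs); omega
      have hTd' : ∀ q ∈ T, q.natDegree ≤ d + 1 := by
        intro q hq
        rcases hTF q hq with h | h
        · omega
        · exact hF q (Finset.mem_of_mem_erase h)
      have hrem : ∀ q : R[X], ∃ r : R[X], 0 < q.natDegree → r.natDegree < q.natDegree ∧
          ∃ (k : ℕ) (a : R[X]), C q.leadingCoeff ^ k * p = a * q + r := by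
        intro q
        by_cases hq : 0 < q.natDegree
        · obtain ⟨k, a, r, h1, h2⟩ := exists_pseudo_remainder p q hq
          exact ⟨r, fun _ => ⟨h1, k, a, h2⟩⟩
        · exact ⟨0, fun h => absurd h hq⟩
      choose rem hrem using hrem
      set G := insert p.eraseLead (T ∪ (T.filter (0 < ·.natDegree)).image rem) with hG
      have hGF : ∀ q ∈ G, q.natDegree ≤ d ∨ q ∈ F.erase p := by
        intro q hq
        simp only [hG, Finset.mem_insert, Finset.mem_union, Finset.mem_image,
          Finset.mem_filter] at hq
        rcases hq with rfl | hq | ⟨s, ⟨hs, hs0⟩, rfl⟩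
        · left; have := eraseLead_natDegree_le p; omega
        · exact hTF q hq
        · left; have := (hrem s hs0).1; have := hTd' s hs; omega
      have hGd : ∀ q ∈ G, q.natDegree ≤ d + 1 := by
        intro q hq
        rcases hGF q hq with h | h
        · omega
        · exact hF q (Finset.mem_of_mem_erase h)
      have hGT : T ⊆ G := fun q hq => by simp [hG, hq]
      have hsub : G.filter (·.natDegree = d + 1) ⊆ (F.filter (·.natDegree = d + 1)).erase p := by
        intro q hq
        rw [Finset.mem_filter] at hq
        rcases hGF q hq.1 with h | h
        · omega
        · rw [Finset.mem_erase] at h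
          simp [h.1, h.2, hq.2]
      obtain ⟨Q, hQ⟩ := ihk G hGd (by
        have hcard := Finset.card_le_card hsub
        rw [Finset.card_erase_of_mem (by simp [hpF, hpd])] at hcard
        omega)
      refine ⟨Q ∪ insert p.leadingCoeff (T.image leadingCoeff), fun u v huv => ?_⟩
      obtain ⟨φ, hφ⟩ := hQ u v fun c hc => huv c (by simp [hc])
      have hlp : SignType.sign (u p.leadingCoeff) = SignType.sign (v p.leadingCoeff) :=
        huv _ (by simp)
      have hlT : ∀ q ∈ T, SignType.sign (u q.leadingCoeff) = SignType.sign (v q.leadingCoeff) :=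
        fun q hq => huv _ (Finset.mem_union_right _ (Finset.mem_insert_of_mem
          (Finset.mem_image_of_mem _ hq)))
      have hFT : F.erase p ⊆ T := fun q hq => hST (Finset.mem_insert_of_mem hq)
      by_cases hu : u p.leadingCoeff = 0
      · have hv : v p.leadingCoeff = 0 := by
          rwa [hu, sign_zero, eq_comm, sign_eq_zero_iff] at hlp
        refine ⟨φ, fun q hq x => ?_⟩
        by_cases hqp : q = p
        · rw [hqp, ← map_eraseLead_of_leadingCoeff_eq_zero hu,
            ← map_eraseLead_of_leadingCoeff_eq_zero hv]
          exact hφ _ (by simp [hG]) x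
        · exact hφ _ (hGT (hFT (Finset.mem_erase.2 ⟨hqp, hq⟩))) x
      · obtain ⟨ψ, hψ⟩ : ∃ ψ, SignMatch u v (insert p T) ψ := by
          refine exists_signMatch_insert (fun q hq => hφ q (hGT hq)) (by omega) hlp hu
            (hST (Finset.mem_insert_self _ _)) ?_
          intro q₀ hq₀ hne x hx
          obtain ⟨q, hq, hqq, hlq⟩ := exists_truncation hTe u hq₀ hne
          rw [← hqq] at hx
          have hqd : 0 < q.natDegree := by
            by_contra h
            have h0 : q.natDegree = 0 := by omega
            rw [eq_C_of_natDegree_eq_zero h0] at hx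
            simp only [map_C, eval_C] at hx
            exact hlq (by rwa [leadingCoeff, h0])
          obtain ⟨-, k, a, e⟩ := hrem q hqd
          have hx' : (q.map v).eval (φ x) = 0 := by
            have := hφ q (hGT hq) x
            rwa [hx, sign_zero, eq_comm, sign_eq_zero_iff] at this
          have hr := hφ (rem q) (by
            simp only [hG, Finset.mem_insert, Finset.mem_union, Finset.mem_image,
              Finset.mem_filter]
            exact Or.inr (Or.inr ⟨q, ⟨hq, hqd⟩, rfl⟩)) x
          have eu := congrArg (fun P => (P.map u).eval x) e
          have ev := congrArg (fun P => (P.map v).eval (φ x)) e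
          simp only [Polynomial.map_mul, Polynomial.map_pow, map_C, Polynomial.map_add, eval_add,
            eval_mul, eval_pow, eval_C, hx, hx', mul_zero, zero_add] at eu ev
          rw [← eu, ← ev, sign_mul, sign_mul, sign_pow, sign_pow, hlT q hq] at hr
          refine mul_left_cancel₀ (pow_ne_zero k ?_) hr
          rwa [← hlT q hq, sign_ne_zero]
        refine ⟨ψ, fun q hq => hψ q ?_⟩
        by_cases hqp : q = p
        · simp [hqp]
        · exact Finset.mem_insert_of_mem (hFT (Finset.mem_erase.2 ⟨hqp, hq⟩))

end Elimination

theorem MvPolynomial.eval₂_cons_eq {R : Type*} [CommRing R] {n : ℕ} (u : R →+* ℝ)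
    (x : Fin n → ℝ) (x₀ : ℝ) (p : MvPolynomial (Fin (n + 1)) R) :
    p.eval₂ u (Fin.cons x₀ x : Fin (n + 1) → ℝ) =
      ((finSuccEquiv R n p).map (eval₂Hom u x)).eval x₀ := by
  have : eval₂Hom u (Fin.cons x₀ x : Fin (n + 1) → ℝ) =
      ((Polynomial.evalRingHom x₀).comp (Polynomial.mapRingHom (eval₂Hom u x))).comp
        (finSuccEquiv R n : MvPolynomial (Fin (n + 1)) R →+* Polynomial (MvPolynomial (Fin n) R)) := by
    apply MvPolynomial.ringHom_ext
    · intro r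
      simp [finSuccEquiv_apply]
    · intro i
      refine Fin.cases ?_ (fun i => ?_) i
      · simp [finSuccEquiv_X_zero]
      · simp [finSuccEquiv_X_succ]
  exact RingHom.congr_fun this p

/-- The sign vectors realized by a finite family of polynomials with parameters are determined by
the signs of finitely many expressions in the parameters. -/
theorem exists_sign_determining_mv {R : Type*} [CommRing R] (n : ℕ)
    (F : Finset (MvPolynomial (Fin n) R)) : ∃ Q : Finset R, ∀ u v : R →+* ℝ,
    (∀ c ∈ Q, SignType.sign (u c) = SignType.sign (v c)) → ∀ x : Fin n → ℝ, ∃ y : Fin n → ℝ,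
      ∀ p ∈ F, SignType.sign (p.eval₂ u x) = SignType.sign (p.eval₂ v y) := by
  classical
  induction n with
  | zero =>
    refine ⟨F.image (MvPolynomial.coeff 0), fun u v huv x => ⟨x, fun p hp => ?_⟩⟩
    have := huv _ (Finset.mem_image_of_mem _ hp)
    obtain ⟨r, rfl⟩ := MvPolynomial.C_surjective (Fin 0) p
    simpa using this
  | succ n ih =>
    obtain ⟨Q', hQ'⟩ := exists_sign_determining (F.image (MvPolynomial.finSuccEquiv R n))
    obtain ⟨Q, hQ⟩ := ih Q'
    refine ⟨Q, fun u v huv x => ?_⟩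
    obtain ⟨y, hy⟩ := hQ u v huv (Fin.tail x)
    obtain ⟨φ, hφ⟩ := hQ' (MvPolynomial.eval₂Hom u (Fin.tail x)) (MvPolynomial.eval₂Hom v y) hy
    refine ⟨Fin.cons (φ (x 0)) y, fun p hp => ?_⟩
    rw [MvPolynomial.eval₂_cons_eq, ← hφ _ (Finset.mem_image_of_mem _ hp), ← Fin.cons_self_tail x,
      MvPolynomial.eval₂_cons_eq]
    simp

section Growth

open Polynomial Filter

/-- Evaluation of a polynomial in two variables. -/
def evalPair (t s : ℝ) : ℝ[X][X] →+* ℝ :=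
  (evalRingHom s).comp (mapRingHom (evalRingHom t))

theorem evalPair_apply (t s : ℝ) (q : ℝ[X][X]) :
    evalPair t s q = (q.map (evalRingHom t)).eval s := rfl

theorem eventually_abs_eval_le (c : ℝ[X]) : ∃ M : ℕ, ∀ᶠ t in atTop, |c.eval t| ≤ t ^ M := by
  obtain ⟨K, hK⟩ := (isBigO_atTop_of_degree_le (P := c) (Q := X ^ c.natDegree)
    (by simp)).bound
  refine ⟨c.natDegree + 1, ?_⟩
  filter_upwards [hK, eventually_ge_atTop K, eventually_ge_atTop 0] with t ht htK ht0
  simp only [eval_pow, eval_X, Real.norm_eq_abs, abs_pow, abs_of_nonneg ht0] at ht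
  rw [pow_succ']
  exact ht.trans (by gcongr)

theorem eventually_one_le_mul_abs_eval {c : ℝ[X]} (hc : c ≠ 0) :
    ∀ᶠ t in atTop, 1 ≤ t * |c.eval t| := by
  rcases Nat.eq_zero_or_pos c.natDegree with h | h
  · rw [eq_C_of_natDegree_eq_zero h] at hc ⊢
    simp only [ne_eq, C_eq_zero] at hc
    filter_upwards [eventually_ge_atTop (1 / |c.coeff 0|)] with t ht
    rw [div_le_iff₀ (abs_pos.2 hc)] at ht
    simpa using ht
  · filter_upwards [(abs_tendsto_atTop c (natDegree_pos_iff_degree_pos.1 h)).eventually_ge_atTop 1,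
      eventually_ge_atTop 1] with t ht ht'
    exact one_le_mul_of_one_le_of_one_le ht' ht

theorem eventually_abs_evalPair_le (k : ℕ) (e : ℝ[X][X]) (he : e.natDegree ≤ k) :
    ∃ M : ℕ, ∀ᶠ t in atTop, ∀ s ≥ 1, |evalPair t s e| ≤ t ^ M * s ^ k := by
  refine induction_with_natDegree_le
    (fun e => ∃ M : ℕ, ∀ᶠ t in atTop, ∀ s ≥ 1, |evalPair t s e| ≤ t ^ M * s ^ k) k ?_ ?_ ?_ e he
  · refine ⟨0, Eventually.of_forall fun t s hs => ?_⟩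
    rw [map_zero, abs_zero]
    positivity
  · intro i c _ hi
    obtain ⟨M, hM⟩ := eventually_abs_eval_le c
    refine ⟨M, ?_⟩
    filter_upwards [hM, eventually_ge_atTop 0] with t ht ht0 s hs
    simp only [evalPair_apply, Polynomial.map_mul, map_C, coe_evalRingHom, Polynomial.map_pow,
      map_X, eval_mul, eval_C, eval_pow, eval_X, abs_mul, abs_pow]
    rw [abs_of_nonneg (zero_le_one.trans hs)]
    gcongr
  · rintro f g - - ⟨M, hM⟩ ⟨M', hM'⟩
    refine ⟨max M M' + 1, ?_⟩
    filter_upwards [hM, hM', eventually_ge_atTop 2] with t h1 h2 ht s hs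
    have ht1 : 1 ≤ t := by linarith
    have e1 : t ^ M ≤ t ^ max M M' := pow_le_pow_right₀ ht1 (le_max_left _ _)
    have e2 : t ^ M' ≤ t ^ max M M' := pow_le_pow_right₀ ht1 (le_max_right _ _)
    have hs0 : 0 ≤ s ^ k := by positivity
    calc |evalPair t s (f + g)| ≤ |evalPair t s f| + |evalPair t s g| := by
          rw [map_add]; exact abs_add_le _ _
      _ ≤ t ^ M * s ^ k + t ^ M' * s ^ k := add_le_add (h1 s hs) (h2 s hs)
      _ ≤ t ^ max M M' * s ^ k + t ^ max M M' * s ^ k := by gcongr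
      _ = 2 * (t ^ max M M' * s ^ k) := by ring
      _ ≤ t * (t ^ max M M' * s ^ k) := by gcongr
      _ = _ := by ring

theorem exists_sign_evalPair_eq_leadingCoeff (q : ℝ[X][X]) :
    ∃ N : ℕ, ∀ᶠ t in atTop, ∀ s ≥ t ^ N,
      SignType.sign (evalPair t s q) = SignType.sign (q.leadingCoeff.eval t) := by
  rcases eq_or_ne q 0 with rfl | hq
  · exact ⟨0, by simp⟩
  have heval : ∀ t s, evalPair t s q =
      evalPair t s q.eraseLead + q.leadingCoeff.eval t * s ^ q.natDegree := by
    intro t s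
    have := congrArg (evalPair t s) q.eraseLead_add_C_mul_X_pow
    rw [← this, map_add]
    simp only [evalPair_apply, Polynomial.map_mul, map_C, coe_evalRingHom, Polynomial.map_pow,
      map_X, eval_mul, eval_C, eval_pow, eval_X]
  rcases Nat.eq_zero_or_pos q.natDegree with hd | hd
  · refine ⟨0, Eventually.of_forall fun t s _ => ?_⟩
    have h0 : q.eraseLead = 0 := by
      rw [eq_C_of_natDegree_eq_zero hd]; simp
    rw [heval, hd, h0]
    simp
  obtain ⟨M, hM⟩ := eventually_abs_evalPair_le (q.natDegree - 1) q.eraseLead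
    (eraseLead_natDegree_le q)
  refine ⟨M + 2, ?_⟩
  filter_upwards [hM, eventually_one_le_mul_abs_eval (leadingCoeff_ne_zero.2 hq),
    eventually_gt_atTop 1] with t h1 h2 ht s hs
  have ht0 : 0 < t := by linarith
  have hs1 : 1 ≤ s := (one_le_pow₀ ht.le).trans hs
  have hs0 : 0 < s := by linarith
  have hsd : s ^ q.natDegree = s * s ^ (q.natDegree - 1) := by
    rw [← pow_succ', Nat.sub_add_cancel hd]
  set c := q.leadingCoeff.eval t
  set e := evalPair t s q.eraseLead
  have hlt : |e| < |c| * s ^ q.natDegree := by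
    have hw : 0 < s ^ (q.natDegree - 1) := by positivity
    have h3 : t ^ M < |c| * s := by
      have : t ^ M * t < (t * |c|) * s := by
        calc t ^ M * t = t ^ (M + 1) := by ring
          _ < t ^ (M + 2) := pow_lt_pow_right₀ ht (by omega)
          _ ≤ s := hs
          _ ≤ (t * |c|) * s := le_mul_of_one_le_left hs0.le h2
      nlinarith
    calc |e| ≤ t ^ M * s ^ (q.natDegree - 1) := h1 s hs1
      _ < |c| * s * s ^ (q.natDegree - 1) := by gcongr
      _ = _ := by rw [hsd]; ring
  rw [heval]
  have hsp : 0 < s ^ q.natDegree := by positivity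
  rcases lt_trichotomy c 0 with hc | hc | hc
  · rw [sign_neg hc, sign_eq_neg_one_iff]
    rw [abs_of_neg hc] at hlt
    have := le_abs_self e
    change e + c * _ < 0
    linarith
  · rw [hc] at hlt
    simp only [abs_zero, zero_mul] at hlt
    exact absurd (abs_nonneg e) (not_le.2 hlt)
  · rw [sign_pos hc, sign_eq_one_iff]
    rw [abs_of_pos hc] at hlt
    have := neg_abs_le e
    change 0 < e + c * _
    linarith

theorem exists_sign_evalPair_eq (Q : Finset ℝ[X][X]) :
    ∃ N : ℕ, ∀ᶠ t in atTop, ∀ s ≥ t ^ N, ∀ s' ≥ t ^ N, ∀ q ∈ Q,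
      SignType.sign (evalPair t s q) = SignType.sign (evalPair t s' q) := by
  choose N hN using exists_sign_evalPair_eq_leadingCoeff
  refine ⟨Q.sup N, ?_⟩
  filter_upwards [(Finset.eventually_all Q).2 fun q _ => hN q, eventually_ge_atTop 1]
    with t ht ht1 s hs s' hs' q hq
  have hle : t ^ N q ≤ t ^ Q.sup N := pow_le_pow_right₀ ht1 (Finset.le_sup hq)
  rw [ht q hq s (hle.trans hs), ht q hq s' (hle.trans hs')]

end Growth

section Separation

open MvPolynomial

/-- Membership in `A` depends only on the signs of the polynomials in `Q`. -/
def SignDetermined {n : ℕ} (Q : Finset (MvPolynomial (Fin n) ℝ)) (A : Set (Fin n → ℝ)) : Prop :=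
  ∀ x y, (∀ q ∈ Q, SignType.sign (eval x q) = SignType.sign (eval y q)) → x ∈ A → y ∈ A

theorem sum_sq_le_isBounded {n : ℕ} (t : ℝ) :
    Bornology.IsBounded {x : Fin n → ℝ | ∑ i, x i ^ 2 ≤ t} := by
  refine (Metric.isBounded_closedBall (x := (0 : Fin n → ℝ)) (r := 1 + |t|)).subset fun x hx => ?_
  rw [mem_closedBall_zero_iff, pi_norm_le_iff_of_nonneg (by positivity)]
  intro i
  have h1 : x i ^ 2 ≤ t :=
    (Finset.single_le_sum (f := fun i => x i ^ 2) (fun i _ => sq_nonneg _)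
      (Finset.mem_univ i)).trans hx
  rw [Real.norm_eq_abs, abs_le]
  have := le_abs_self t
  constructor <;> nlinarith [abs_nonneg t]

/-- A Łojasiewicz-type inequality on a closed set determined by finitely many polynomial signs. -/
theorem exists_lojasiewicz {n : ℕ} {A : Set (Fin n → ℝ)} (hA : IsClosed A)
    {Q : Finset (MvPolynomial (Fin n) ℝ)} (hQ : SignDetermined Q A)
    (G : Finset (MvPolynomial (Fin n) ℝ)) (h : MvPolynomial (Fin n) ℝ) (h0 : ∀ x, 0 ≤ eval x h)
    (hne : ∀ x ∈ A, (∀ g ∈ G, 0 < eval x g) → eval x h ≠ 0) :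
    ∃ (N : ℕ) (T : ℝ), ∀ x ∈ A, (∀ g ∈ G, 0 < eval x g) →
      (∏ g ∈ G, eval x g) ^ N <
        (T * (1 + ∑ i, x i ^ 2) * (1 + ∏ g ∈ G, eval x g)) ^ N * eval x h := by
  classical
  let ι : ℝ →+* Polynomial (Polynomial ℝ) := Polynomial.C.comp Polynomial.C
  have hι : ∀ t s, (evalPair t s).comp ι = RingHom.id ℝ := by
    intro t s; ext r; simp [ι]
  have hmap : ∀ t s (x : Fin n → ℝ) (p : MvPolynomial (Fin n) ℝ),
      (map ι p).eval₂ (evalPair t s) x = eval x p := by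
    intro t s x p
    rw [eval₂_map, hι]; rfl
  let E₁ : MvPolynomial (Fin n) (Polynomial (Polynomial ℝ)) :=
    C (Polynomial.C Polynomial.X : Polynomial (Polynomial ℝ)) - map ι (∑ i, X i ^ 2)
  let E₂ : MvPolynomial (Fin n) (Polynomial (Polynomial ℝ)) :=
    C (Polynomial.C Polynomial.X : Polynomial (Polynomial ℝ)) * map ι (∏ g ∈ G, g) - 1
  let E₃ : MvPolynomial (Fin n) (Polynomial (Polynomial ℝ)) :=
    1 - C Polynomial.X * map ι h
  have hE₁ : ∀ t s (x : Fin n → ℝ), E₁.eval₂ (evalPair t s) x = t - ∑ i, x i ^ 2 := by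
    intro t s x
    simp only [E₁, eval₂_sub, hmap, eval₂_C]
    simp [evalPair_apply]
  have hE₂ : ∀ t s (x : Fin n → ℝ),
      E₂.eval₂ (evalPair t s) x = t * (∏ g ∈ G, eval x g) - 1 := by
    intro t s x
    simp only [E₂, eval₂_sub, eval₂_mul, hmap, eval₂_C, eval₂_one]
    simp [evalPair_apply]
  have hE₃ : ∀ t s (x : Fin n → ℝ), E₃.eval₂ (evalPair t s) x = 1 - s * eval x h := by
    intro t s x
    simp only [E₃, eval₂_sub, eval₂_mul, hmap, eval₂_C, eval₂_one]
    simp [evalPair_apply]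
  obtain ⟨S, hS⟩ := exists_sign_determining_mv n
    ((Q ∪ G).image (map ι) ∪ {E₁, E₂, E₃})
  obtain ⟨N, hN⟩ := exists_sign_evalPair_eq S
  obtain ⟨T, hT⟩ := Filter.eventually_atTop.1 hN
  have key : ∀ t ≥ T, 0 < t → ∀ x ∈ A, (∀ g ∈ G, 0 < eval x g) → ∑ i, x i ^ 2 ≤ t →
      1 ≤ t * ∏ g ∈ G, eval x g → 1 < t ^ N * eval x h := by
    intro t htT ht0 x hxA hxG hxt hxπ
    by_contra! hcon
    let K : Set (Fin n → ℝ) := A ∩ ({x | ∑ i, x i ^ 2 ≤ t} ∩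
      ({x | ∀ g ∈ G, 0 ≤ eval x g} ∩ {x | 1 ≤ t * ∏ g ∈ G, eval x g}))
    have hcont : ∀ p : MvPolynomial (Fin n) ℝ, Continuous fun x : Fin n → ℝ => eval x p :=
      fun p => MvPolynomial.continuous_eval p
    have hKclosed : IsClosed K := by
      refine hA.inter (IsClosed.inter ?_ (IsClosed.inter ?_ ?_))
      · exact isClosed_le (by fun_prop) continuous_const
      · have : {x : Fin n → ℝ | ∀ g ∈ G, 0 ≤ eval x g} =
            ⋂ g ∈ G, {x | 0 ≤ eval x g} := by ext; simp
        rw [this]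
        exact isClosed_biInter fun g _ => isClosed_le continuous_const (hcont g)
      · exact isClosed_le continuous_const
          (continuous_const.mul (continuous_finsetProd _ fun g _ => hcont g))
    have hKc : IsCompact K := Metric.isCompact_of_isClosed_isBounded hKclosed
      ((sum_sq_le_isBounded t).subset fun y hy => hy.2.1)
    obtain ⟨z, hz, hzmin⟩ := hKc.exists_isMinOn
      ⟨x, hxA, hxt, fun g hg => (hxG g hg).le, hxπ⟩ (hcont h).continuousOn
    have hzG : ∀ g ∈ G, 0 < eval z g := by
      intro g hg
      refine lt_of_le_of_ne (hz.2.2.1 g hg) fun h0 => ?_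
      have := hz.2.2.2
      rw [mem_ofPred_eq, Finset.prod_eq_zero hg h0.symm] at this
      simp at this
      linarith
    have hm : 0 < eval z h := lt_of_le_of_ne (h0 z) (hne z hz.1 hzG).symm
    set s := max (t ^ N) (2 / eval z h) with hs
    obtain ⟨y, hy⟩ := hS (evalPair t (t ^ N)) (evalPair t s)
      (hT t htT _ le_rfl _ (le_max_left _ _)) x
    have hyQG : ∀ p ∈ Q ∪ G, SignType.sign (eval x p) = SignType.sign (eval y p) := by
      intro p hp
      have := hy (map ι p) (Finset.mem_union_left _ (Finset.mem_image_of_mem _ hp))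
      rwa [hmap, hmap] at this
    have h₁ := hy E₁ (by simp)
    have h₂ := hy E₂ (by simp)
    have h₃ := hy E₃ (by simp)
    rw [hE₁, hE₁] at h₁
    rw [hE₂, hE₂] at h₂
    rw [hE₃, hE₃] at h₃
    have nonneg_of : ∀ a b : ℝ, SignType.sign a = SignType.sign b → 0 ≤ a → 0 ≤ b := by
      intro a b hab ha
      rwa [← sign_nonneg_iff, ← hab, sign_nonneg_iff]
    have hyG : ∀ g ∈ G, 0 < eval y g := by
      intro g hg
      have := hyQG g (Finset.mem_union_right _ hg)
      rwa [sign_pos (hxG g hg), eq_comm, sign_eq_one_iff] at this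
    have hyK : y ∈ K := by
      refine ⟨hQ x y (fun q hq => hyQG q (Finset.mem_union_left _ hq)) hxA, ?_,
        fun g hg => (hyG g hg).le, ?_⟩
      · exact sub_nonneg.1 (nonneg_of _ _ h₁ (sub_nonneg.2 hxt))
      · exact sub_nonneg.1 (nonneg_of _ _ h₂ (sub_nonneg.2 hxπ))
    have h4 := sub_nonneg.1 (nonneg_of _ _ h₃ (sub_nonneg.2 hcon))
    have h5 : eval z h ≤ eval y h := hzmin hyK
    have h6 : 2 ≤ s * eval z h := by
      rw [← div_le_iff₀ hm]; exact le_max_right _ _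
    have hs0 : 0 ≤ s := le_trans (by positivity) (le_max_left _ _)
    nlinarith
  refine ⟨N, max T 1, fun x hxA hxG => ?_⟩
  have hπ : 0 < ∏ g ∈ G, eval x g := Finset.prod_pos hxG
  have hsum : 0 ≤ ∑ i, x i ^ 2 := Finset.sum_nonneg fun i _ => sq_nonneg _
  set π := ∏ g ∈ G, eval x g with hπdef
  set w := ∑ i, x i ^ 2
  set T' := max T 1
  have hT1 : 1 ≤ T' := le_max_right _ _
  have hbase : 1 + w ≤ T' * (1 + w) := le_mul_of_one_le_left (by linarith) hT1
  have hT'w : T' ≤ T' * (1 + w) := le_mul_of_one_le_right (by linarith) (by linarith)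
  have ht : T' * (1 + w) ≤ T' * (1 + w) * (1 + π) / π := by
    rw [le_div_iff₀ hπ]
    gcongr
    linarith
  have := key (T' * (1 + w) * (1 + π) / π) ((le_max_left T 1).trans (hT'w.trans ht))
    (by positivity) x hxA hxG (by change w ≤ _; linarith) (by
      rw [div_mul_cancel₀ _ hπ.ne']
      nlinarith)
  rwa [div_pow, div_mul_eq_mul_div, lt_div_iff₀ (by positivity), one_mul] at this

/-- A closed set determined by finitely many polynomial signs is a finite intersection of finite
unions of sets `{g ≤ 0}`. -/
theorem exists_cnf {n : ℕ} {A : Set (Fin n → ℝ)} (hA : IsClosed A)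
    {Q : Finset (MvPolynomial (Fin n) ℝ)} (hQ : SignDetermined Q A) :
    ∃ 𝒟 : Finset (Finset (MvPolynomial (Fin n) ℝ)),
      ∀ x, x ∈ A ↔ ∀ D ∈ 𝒟, ∃ g ∈ D, eval x g ≤ 0 := by
  classical
  have hcell : ∀ σ : Q → SignType, ∃ D : Finset (MvPolynomial (Fin n) ℝ),
      (∀ x ∉ A, (∀ q : Q, SignType.sign (eval x q.1) = σ q) → ∀ g ∈ D, 0 < eval x g) ∧
      ((∃ x ∉ A, ∀ q : Q, SignType.sign (eval x q.1) = σ q) → ∀ x ∈ A, ∃ g ∈ D, eval x g ≤ 0) := by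
    intro σ
    by_cases hσ : ∃ x₀ ∉ A, ∀ q : Q, SignType.sign (eval x₀ q.1) = σ q
    swap
    · exact ⟨∅, by simp, fun h => absurd h hσ⟩
    obtain ⟨x₀, hx₀, hx₀σ⟩ := hσ
    set G : Finset (MvPolynomial (Fin n) ℝ) :=
      (Finset.univ.filter fun q : Q => σ q ≠ 0).image fun q => C ((σ q : ℤ) : ℝ) * q.1 with hG
    set h : MvPolynomial (Fin n) ℝ := ∑ q ∈ Finset.univ.filter (fun q : Q => σ q = 0), q.1 ^ 2
      with hh
    have hhx : ∀ x, eval x h = ∑ q ∈ Finset.univ.filter (fun q : Q => σ q = 0), eval x q.1 ^ 2 := by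
      intro x; simp [hh]
    have hsign : ∀ q : Q, ∀ r : ℝ, σ q ≠ 0 →
        (0 < ((σ q : ℤ) : ℝ) * r ↔ SignType.sign r = σ q) := by
      intro q r hq
      rcases hq' : σ q with _ | _ | _
      · exact absurd hq' hq
      · simp [SignType.neg_eq_neg_one, sign_eq_neg_one_iff]
      · simp [SignType.pos_eq_one, sign_eq_one_iff]
    have hiff : ∀ x, ((∀ g ∈ G, 0 < eval x g) ∧ eval x h = 0) ↔
        ∀ q : Q, SignType.sign (eval x q.1) = σ q := by
      intro x
      rw [hhx, Finset.sum_eq_zero_iff_of_nonneg fun q _ => sq_nonneg _]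
      simp only [hG, Finset.mem_image, Finset.mem_filter, Finset.mem_univ, true_and,
        forall_exists_index, and_imp, forall_apply_eq_imp_iff₂, map_mul, eval_C,
        pow_eq_zero_iff two_ne_zero]
      constructor
      · rintro ⟨h1, h2⟩ q
        by_cases hq : σ q = 0
        · rw [hq, h2 q hq, sign_zero]
        · exact (hsign q _ hq).1 (h1 q hq)
      · intro hx
        refine ⟨fun q hq => (hsign q _ hq).2 (hx q), fun q hq => ?_⟩
        rw [← sign_eq_zero_iff, hx q, hq]
    obtain ⟨N, T, hNT⟩ := exists_lojasiewicz hA hQ G h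
      (fun x => by rw [hhx]; positivity) fun x hxA hxG hx0 => by
        have hx := (hiff x).1 ⟨hxG, hx0⟩
        exact hx₀ (hQ x x₀ (fun q hq => (hx ⟨q, hq⟩).trans (hx₀σ ⟨q, hq⟩).symm) hxA)
    set E : MvPolynomial (Fin n) ℝ := (∏ g ∈ G, g) ^ N -
      (C T * (1 + ∑ i, X i ^ 2) * (1 + ∏ g ∈ G, g)) ^ N * h with hE
    have hEx : ∀ x, eval x E = (∏ g ∈ G, eval x g) ^ N -
        (T * (1 + ∑ i, x i ^ 2) * (1 + ∏ g ∈ G, eval x g)) ^ N * eval x h := by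
      intro x; simp [hE]
    refine ⟨insert E G, fun x _ hx g hg => ?_, fun _ x hxA => ?_⟩
    · obtain ⟨hxG, hx0⟩ := (hiff x).2 hx
      rcases Finset.mem_insert.1 hg with rfl | hg
      · rw [hEx, hx0, mul_zero, sub_zero]
        exact pow_pos (Finset.prod_pos hxG) N
      · exact hxG g hg
    · by_cases hxG : ∀ g ∈ G, 0 < eval x g
      · refine ⟨E, Finset.mem_insert_self _ _, ?_⟩
        rw [hEx]
        exact (sub_neg.2 (hNT x hxA hxG)).le
      · push Not at hxG
        obtain ⟨g, hg, hgx⟩ := hxG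
        exact ⟨g, Finset.mem_insert_of_mem hg, hgx⟩
  choose D hD hD' using hcell
  refine ⟨(Finset.univ.filter fun σ : Q → SignType =>
    ∃ x ∉ A, ∀ q : Q, SignType.sign (eval x q.1) = σ q).image D, fun x => ⟨fun hx E hE => ?_,
    fun hx => ?_⟩⟩
  · simp only [Finset.mem_image, Finset.mem_filter, Finset.mem_univ, true_and] at hE
    obtain ⟨σ, hσ, rfl⟩ := hE
    exact hD' σ hσ x hx
  · by_contra hxA
    obtain ⟨g, hg, hgx⟩ := hx (D fun q => SignType.sign (eval x q.1))
      (Finset.mem_image_of_mem _ (by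
        simp only [Finset.mem_filter, Finset.mem_univ, true_and]
        exact ⟨x, hxA, fun _ => rfl⟩))
    exact absurd (hD _ x hxA (fun _ => rfl) g hg) (not_lt.2 hgx)

end Separation

section SignDetermination

open MvPolynomial

theorem SignDetermined.mono {n : ℕ} {Q Q' : Finset (MvPolynomial (Fin n) ℝ)}
    {A : Set (Fin n → ℝ)} (h : SignDetermined Q A) (hQ : Q ⊆ Q') : SignDetermined Q' A :=
  fun x y hxy => h x y fun q hq => hxy q (hQ hq)

theorem IsBasicSemialgebraic.exists_signDetermined {n : ℕ} {A : Set (Fin n → ℝ)}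
    (hA : IsBasicSemialgebraic A) : ∃ Q, SignDetermined Q A := by
  classical
  obtain ⟨p, k, q, rfl⟩ := hA
  refine ⟨insert p (Finset.univ.image q), fun x y hxy hx => ⟨?_, fun j => ?_⟩⟩
  · have := hxy p (Finset.mem_insert_self _ _)
    rwa [hx.1, sign_zero, eq_comm, sign_eq_zero_iff] at this
  · have := hxy (q j) (Finset.mem_insert_of_mem (Finset.mem_image_of_mem _ (Finset.mem_univ j)))
    rwa [sign_pos (hx.2 j), eq_comm, sign_eq_one_iff] at this

theorem IsSemialgebraic.exists_signDetermined {n : ℕ} {A : Set (Fin n → ℝ)}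
    (hA : IsSemialgebraic A) : ∃ Q, SignDetermined Q A := by
  classical
  obtain ⟨N, T, hT, rfl⟩ := hA
  choose Q hQ using fun i => (hT i).exists_signDetermined
  refine ⟨Finset.univ.biUnion Q, fun x y hxy hx => ?_⟩
  obtain ⟨i, hi⟩ := mem_iUnion.1 hx
  exact mem_iUnion.2 ⟨i, (hQ i).mono (Finset.subset_biUnion_of_mem Q (Finset.mem_univ i)) x y hxy hi⟩

/-- The sets where a piecewise polynomial function dominates one of its pieces are determined by
finitely many polynomial signs. -/
theorem exists_signDetermined_le {n N : ℕ} {f : (Fin n → ℝ) → ℝ} {S : Fin N → Set (Fin n → ℝ)}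
    {p : Fin N → MvPolynomial (Fin n) ℝ} (hS : ∀ i, IsSemialgebraic (S i))
    (hU : (⋃ i, S i) = Set.univ) (hf : ∀ i, ∀ x ∈ S i, f x = eval x (p i)) (k : Fin N) :
    ∃ Q, SignDetermined Q {x | eval x (p k) ≤ f x} := by
  classical
  choose Q hQ using fun i => (hS i).exists_signDetermined
  refine ⟨Finset.univ.biUnion Q ∪ Finset.univ.image fun i => p i - p k, fun x y hxy hx => ?_⟩
  obtain ⟨i, hi⟩ := mem_iUnion.1 (hU.symm ▸ mem_univ x)
  have hyi : y ∈ S i := (hQ i).mono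
    ((Finset.subset_biUnion_of_mem Q (Finset.mem_univ i)).trans Finset.subset_union_left) x y hxy hi
  have h := hxy (p i - p k)
    (Finset.mem_union_right _ (Finset.mem_image_of_mem _ (Finset.mem_univ i)))
  rw [mem_ofPred_eq, hf i x hi, ← sub_nonneg, ← map_sub, ← sign_nonneg_iff, h, sign_nonneg_iff,
    map_sub, sub_nonneg] at hx
  rwa [mem_ofPred_eq, hf i y hyi]

theorem isClosed_eval_le {n : ℕ} {f : (Fin n → ℝ) → ℝ} (hf : UpperSemicontinuous f)
    (p : MvPolynomial (Fin n) ℝ) : IsClosed {x | eval x p ≤ f x} := by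
  have h := hf.add (MvPolynomial.continuous_eval p).neg.upperSemicontinuous
  convert upperSemicontinuous_iff_isClosed_preimage.1 h 0 using 1
  ext x
  simp

end SignDetermination

section PolyMap

variable {n m : ℕ} {P Q : (Fin n → ℝ) → (Fin m → ℝ) → ℝ}

theorem isPolyMap_eval_left (p : MvPolynomial (Fin n) ℝ) :
    IsPolyMap fun x (_ : Fin m → ℝ) => MvPolynomial.eval x p :=
  ⟨MvPolynomial.rename Sum.inl p, fun x y => by
    rw [MvPolynomial.eval_rename, Sum.elim_comp_inl]⟩

theorem isPolyMap_apply (i : Fin m) : IsPolyMap fun (_ : Fin n → ℝ) (y : Fin m → ℝ) => y i :=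
  ⟨MvPolynomial.X (Sum.inr i), fun x y => by simp⟩

theorem isPolyMap_const (c : ℝ) : IsPolyMap fun (_ : Fin n → ℝ) (_ : Fin m → ℝ) => c :=
  ⟨MvPolynomial.C c, fun x y => by simp⟩

theorem IsPolyMap.add (hP : IsPolyMap P) (hQ : IsPolyMap Q) :
    IsPolyMap fun x y => P x y + Q x y := by
  obtain ⟨p, hp⟩ := hP
  obtain ⟨q, hq⟩ := hQ
  exact ⟨p + q, fun x y => by rw [map_add]; exact congrArg₂ _ (hp x y) (hq x y)⟩

theorem IsPolyMap.sub (hP : IsPolyMap P) (hQ : IsPolyMap Q) :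
    IsPolyMap fun x y => P x y - Q x y := by
  obtain ⟨p, hp⟩ := hP
  obtain ⟨q, hq⟩ := hQ
  exact ⟨p - q, fun x y => by rw [map_sub]; exact congrArg₂ _ (hp x y) (hq x y)⟩

theorem IsPolyMap.mul (hP : IsPolyMap P) (hQ : IsPolyMap Q) :
    IsPolyMap fun x y => P x y * Q x y := by
  obtain ⟨p, hp⟩ := hP
  obtain ⟨q, hq⟩ := hQ
  exact ⟨p * q, fun x y => by rw [map_mul]; exact congrArg₂ _ (hp x y) (hq x y)⟩

theorem isPolyMap_sum {α : Type*} (s : Finset α) {P : α → (Fin n → ℝ) → (Fin m → ℝ) → ℝ}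
    (hP : ∀ i ∈ s, IsPolyMap (P i)) : IsPolyMap fun x y => ∑ i ∈ s, P i x y := by
  choose! p hp using hP
  refine ⟨∑ i ∈ s, p i, fun x y => ?_⟩
  rw [map_sum]
  exact Finset.sum_congr rfl fun i hi => hp i hi x y

theorem isPolyMap_prod {α : Type*} (s : Finset α) {P : α → (Fin n → ℝ) → (Fin m → ℝ) → ℝ}
    (hP : ∀ i ∈ s, IsPolyMap (P i)) : IsPolyMap fun x y => ∏ i ∈ s, P i x y := by
  choose! p hp using hP
  refine ⟨∏ i ∈ s, p i, fun x y => ?_⟩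
  rw [map_prod]
  exact Finset.prod_congr rfl fun i hi => hp i hi x y

end PolyMap

section Blend

variable {ι : Type*}

/-- Iterated convex combination of the values `p k`, with weights `w k`, starting from `c`. -/
def blend (c : ℝ) (w p : ι → ℝ) : List ι → ℝ
  | [] => c
  | k :: l => blend c w p l + w k * (p k - blend c w p l)

theorem blend_le {c b : ℝ} {w p : ι → ℝ} (hc : c ≤ b) (hw : ∀ k, w k ∈ Icc 0 1)
    (hp : ∀ k, w k ≠ 0 → p k ≤ b) (l : List ι) : blend c w p l ≤ b := by
  induction l with
  | nil => exact hc
  | cons k l ih =>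
    rw [blend]
    by_cases h : w k = 0
    · simpa [h] using ih
    · nlinarith [hp k h, (hw k).1, (hw k).2]

theorem blend_eq {c : ℝ} {w p : ι → ℝ} {k : ι} (hk : w k = 1) (hw : ∀ j ≠ k, w j = 0)
    {l : List ι} (hl : k ∈ l) : blend c w p l = p k := by
  induction l with
  | nil => simp at hl
  | cons j l ih =>
    rw [blend]
    by_cases h : j = k
    · rw [h, hk]
      ring
    · rw [hw j h, zero_mul, add_zero]
      exact ih ((List.mem_cons.1 hl).resolve_left (Ne.symm h))

theorem isPolyMap_blend {n m : ℕ} {c : (Fin n → ℝ) → (Fin m → ℝ) → ℝ}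
    {w p : ι → (Fin n → ℝ) → (Fin m → ℝ) → ℝ} (hc : IsPolyMap c) (hw : ∀ k, IsPolyMap (w k))
    (hp : ∀ k, IsPolyMap (p k)) (l : List ι) :
    IsPolyMap fun x y => blend (c x y) (fun k => w k x y) (fun k => p k x y) l := by
  induction l with
  | nil => exact hc
  | cons k l ih => exact ih.add ((hw k).mul ((hp k).sub ih))

end Blend

section CnfIndicator

variable {α : Type*}

/-- The polynomial `∏ D ∈ 𝒟, (1 - ∏ g ∈ D, (1 - u g))`, which interpolates the truth value of a
conjunctive normal form. -/
def cnfIndicator (𝒟 : Finset (Finset α)) (u : α → ℝ) : ℝ :=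
  ∏ D ∈ 𝒟, (1 - ∏ g ∈ D, (1 - u g))

theorem cnfIndicator_mem_Icc {𝒟 : Finset (Finset α)} {u : α → ℝ} (hu : ∀ g, u g ∈ Icc 0 1) :
    cnfIndicator 𝒟 u ∈ Icc 0 1 := by
  have h : ∀ D ∈ 𝒟, (1 - ∏ g ∈ D, (1 - u g)) ∈ Icc (0 : ℝ) 1 := fun D _ => by
    have h0 : 0 ≤ ∏ g ∈ D, (1 - u g) := Finset.prod_nonneg fun g _ => sub_nonneg.2 (hu g).2
    have h1 : ∏ g ∈ D, (1 - u g) ≤ 1 :=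
      Finset.prod_le_one (fun g _ => sub_nonneg.2 (hu g).2) fun g _ => by linarith [(hu g).1]
    constructor <;> linarith
  exact ⟨Finset.prod_nonneg fun D hD => (h D hD).1,
    Finset.prod_le_one (fun D hD => (h D hD).1) fun D hD => (h D hD).2⟩

theorem exists_ne_zero_of_cnfIndicator_ne_zero {𝒟 : Finset (Finset α)} {u : α → ℝ}
    (h : cnfIndicator 𝒟 u ≠ 0) : ∀ D ∈ 𝒟, ∃ g ∈ D, u g ≠ 0 := by
  intro D hD
  by_contra! h0
  refine Finset.prod_ne_zero_iff.1 h D hD ?_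
  rw [Finset.prod_eq_one fun g hg => by rw [h0 g hg, sub_zero], sub_self]

theorem cnfIndicator_eq_one {𝒟 : Finset (Finset α)} {u : α → ℝ}
    (h : ∀ D ∈ 𝒟, ∃ g ∈ D, u g = 1) : cnfIndicator 𝒟 u = 1 := by
  refine Finset.prod_eq_one fun D hD => ?_
  obtain ⟨g, hg, hug⟩ := h D hD
  rw [Finset.prod_eq_zero hg (by rw [hug, sub_self]), sub_zero]

theorem isPolyMap_cnfIndicator {n m : ℕ} (𝒟 : Finset (Finset α))
    {u : α → (Fin n → ℝ) → (Fin m → ℝ) → ℝ} (hu : ∀ g, IsPolyMap (u g)) :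
    IsPolyMap fun x y => cnfIndicator 𝒟 fun g => u g x y :=
  isPolyMap_prod 𝒟 fun D _ => (isPolyMap_const 1).sub
    (isPolyMap_prod D fun g _ => (isPolyMap_const 1).sub (hu g))

end CnfIndicator

theorem neg_sum_one_add_sq_le {ι : Type*} [Fintype ι] (r : ι → ℝ) (k : ι) :
    -∑ i, (1 + r i ^ 2) ≤ r k := by
  have := Finset.single_le_sum (f := fun i => 1 + r i ^ 2) (fun i _ => by positivity)
    (Finset.mem_univ k)
  nlinarith [sq_nonneg (r k + 1)]

/-- A bilevel problem whose lower level is linear, and whose pessimistic value is the largest of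
the polynomials `p k` lying below `f`. -/
theorem exists_bilevel_of_cnf {n N : ℕ} {f : (Fin n → ℝ) → ℝ}
    {p : Fin N → MvPolynomial (Fin n) ℝ} (hf : ∀ x, ∃ k, f x = MvPolynomial.eval x (p k))
    {𝒟 : Fin N → Finset (Finset (MvPolynomial (Fin n) ℝ))}
    (h𝒟 : ∀ k x, MvPolynomial.eval x (p k) ≤ f x ↔
      ∀ D ∈ 𝒟 k, ∃ g ∈ D, MvPolynomial.eval x g ≤ 0) :
    ∃ (m : ℕ) (P Q : (Fin n → ℝ) → (Fin m → ℝ) → ℝ) (a b : Fin m → ℝ),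
      IsPolyMap P ∧ IsPolyMap Q ∧ (∀ x, ConvexOn ℝ Set.univ (Q x)) ∧
      ∀ x, valPess P Q (boundedBox a b) x = ((f x : ℝ) : EReal) := by
  classical
  let H : Finset (MvPolynomial (Fin n) ℝ) := Finset.univ.biUnion fun k => (𝒟 k).biUnion id
  have hH : ∀ k, ∀ D ∈ 𝒟 k, ∀ g ∈ D, g ∈ H := fun k D hD g hg =>
    Finset.mem_biUnion.2 ⟨k, Finset.mem_univ k, Finset.mem_biUnion.2 ⟨D, hD, hg⟩⟩
  let e := Fintype.equivFin (H ⊕ Fin N)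
  let m := Fintype.card (H ⊕ Fin N)
  let u : MvPolynomial (Fin n) ℝ → (Fin n → ℝ) → (Fin m → ℝ) → ℝ := fun g _ y =>
    if h : g ∈ H then y (e (Sum.inl ⟨g, h⟩)) else 0
  have hu : ∀ g, IsPolyMap (u g) := by
    intro g
    by_cases h : g ∈ H
    · simpa only [u, dif_pos h] using isPolyMap_apply _
    · simpa only [u, dif_neg h] using isPolyMap_const 0
  let w : Fin N → (Fin n → ℝ) → (Fin m → ℝ) → ℝ := fun k x y =>
    y (e (Sum.inr k)) * cnfIndicator (𝒟 k) fun g => u g x y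
  let P : (Fin n → ℝ) → (Fin m → ℝ) → ℝ := fun x y =>
    blend (-∑ k, (1 + MvPolynomial.eval x (p k) ^ 2)) (fun k => w k x y)
      (fun k => MvPolynomial.eval x (p k)) (List.finRange N)
  let Q : (Fin n → ℝ) → (Fin m → ℝ) → ℝ := fun x y => ∑ g ∈ H, MvPolynomial.eval x g * u g x y
  refine ⟨m, P, Q, 0, 1, ?_, isPolyMap_sum H fun g _ => (isPolyMap_eval_left g).mul (hu g),
    fun x => ?_, fun x => ?_⟩
  · refine isPolyMap_blend ?_
      (fun k => (isPolyMap_apply _).mul (isPolyMap_cnfIndicator (𝒟 k) hu))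
      (fun k => isPolyMap_eval_left (p k)) _
    convert isPolyMap_eval_left (m := m) (-∑ k, (1 + p k ^ 2)) with x y
    simp
  · refine ⟨convex_univ, fun y _ z _ s t _ _ _ => le_of_eq ?_⟩
    simp only [Q, smul_eq_mul, Finset.mul_sum, ← Finset.sum_add_distrib]
    refine Finset.sum_congr rfl fun g hg => ?_
    simp only [u, dif_pos hg, Pi.add_apply, Pi.smul_apply, smul_eq_mul]
    ring
  have hbox : ∀ y ∈ boundedBox (0 : Fin m → ℝ) 1, ∀ g, u g x y ∈ Icc 0 1 := by
    intro y hy g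
    by_cases h : g ∈ H
    · simp only [u, dif_pos h]
      exact hy _
    · simp [u, dif_neg h]
  let y₀ : (Fin N → ℝ) → Fin m → ℝ := fun z i =>
    Sum.elim (fun g : H => if MvPolynomial.eval x g.1 ≤ 0 then (1 : ℝ) else 0) z (e.symm i)
  have hu₀ : ∀ z, ∀ g ∈ H, u g x (y₀ z) = if MvPolynomial.eval x g ≤ 0 then 1 else 0 := by
    intro z g hg
    simp [u, y₀, dif_pos hg]
  have hy₀ : ∀ z : Fin N → ℝ, (∀ k, z k ∈ Icc 0 1) → y₀ z ∈ boundedBox (0 : Fin m → ℝ) 1 := by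
    intro z hz i
    simp only [y₀]
    rcases e.symm i with g | k
    · simp only [Sum.elim_inl]
      split_ifs <;> simp
    · exact hz k
  have hmin : ∀ z, ∀ y ∈ boundedBox (0 : Fin m → ℝ) 1, ∀ g ∈ H,
      MvPolynomial.eval x g * u g x (y₀ z) ≤ MvPolynomial.eval x g * u g x y := by
    intro z y hy g hg
    rw [hu₀ z g hg]
    have := hbox y hy g
    split_ifs with h
    · nlinarith [this.2]
    · nlinarith [this.1]
  apply le_antisymm
  · refine iSup₂_le fun y hy => EReal.coe_le_coe_iff.2 ?_
    have hz : y₀ 0 ∈ boundedBox (0 : Fin m → ℝ) 1 := hy₀ 0 fun k => by simp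
    have hu0 : ∀ g ∈ H, u g x y ≠ 0 → MvPolynomial.eval x g ≤ 0 := by
      intro g hg hne
      by_contra! hpos
      have heq := (Finset.sum_eq_sum_iff_of_le (hmin 0 y hy.1)).1
        ((Finset.sum_le_sum (hmin 0 y hy.1)).antisymm (hy.2 _ hz)) g hg
      rw [hu₀ 0 g hg, if_neg (not_le.2 hpos), mul_zero, eq_comm, mul_eq_zero] at heq
      exact heq.elim hpos.ne' hne
    obtain ⟨k₀, hk₀⟩ := hf x
    refine blend_le ((neg_sum_one_add_sq_le _ k₀).trans hk₀.ge) (fun k => ?_) (fun k hk => ?_) _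
    · exact ⟨mul_nonneg (hy.1 _).1 (cnfIndicator_mem_Icc (hbox y hy.1)).1,
        mul_le_one₀ (hy.1 _).2 (cnfIndicator_mem_Icc (hbox y hy.1)).1
          (cnfIndicator_mem_Icc (hbox y hy.1)).2⟩
    · refine (h𝒟 k x).2 fun D hD => ?_
      obtain ⟨g, hg, hgu⟩ :=
        exists_ne_zero_of_cnfIndicator_ne_zero (right_ne_zero_of_mul hk) D hD
      exact ⟨g, hg, hu0 g (hH k D hD g hg) hgu⟩
  · obtain ⟨k, hk⟩ := hf x
    have hz : ∀ j, (Pi.single k 1 : Fin N → ℝ) j ∈ Icc 0 1 := by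
      intro j
      rw [Pi.single_apply]
      split_ifs <;> simp
    refine le_iSup₂_of_le (y₀ (Pi.single k 1))
      ⟨hy₀ _ hz, fun y hy => Finset.sum_le_sum (hmin _ y hy)⟩ (EReal.coe_le_coe_iff.2 ?_)
    have hz' : ∀ j, y₀ (Pi.single k 1) (e (Sum.inr j)) = (Pi.single k 1 : Fin N → ℝ) j := by
      intro j
      simp [y₀]
    refine (hk.trans (blend_eq (p := fun k => MvPolynomial.eval x (p k)) (k := k) ?_
      (fun j hj => ?_) (List.mem_finRange k)).symm).le
    · have : cnfIndicator (𝒟 k) (fun g => u g x (y₀ (Pi.single k 1))) = 1 :=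
        cnfIndicator_eq_one fun D hD => by
          obtain ⟨g, hg, hgx⟩ := (h𝒟 k x).1 hk.ge D hD
          exact ⟨g, hg, by rw [hu₀ _ g (hH k D hD g hg), if_pos hgx]⟩
      simp only [w]
      rw [this, hz', Pi.single_eq_same, mul_one]
    · simp only [w]
      rw [hz', Pi.single_eq_of_ne hj, zero_mul]

/-- every upper semicontinuous piecewise polynomial function is the pessimistic
value function of a polynomial bilevel problem with convex lower-level objective over a
bounded box. -/
theorem usc_piecewise_poly_is_convex_bounded_pessimistic_value (n : ℕ)
    (f : (Fin n → ℝ) → ℝ)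
    (hf : IsPiecewisePolynomial f) (husc : UpperSemicontinuous f) :
    ∃ (m : ℕ) (P Q : (Fin n → ℝ) → (Fin m → ℝ) → ℝ) (a b : Fin m → ℝ),
      IsPolyMap P ∧ IsPolyMap Q ∧ (∀ x, ConvexOn ℝ Set.univ (Q x)) ∧
      ∀ x, valPess P Q (boundedBox a b) x = ((f x : ℝ) : EReal) := by
  obtain ⟨N, S, p, hS, -, hU, hfp⟩ := hf
  choose Q hQ using exists_signDetermined_le hS hU hfp
  choose 𝒟 h𝒟 using fun k => exists_cnf (isClosed_eval_le husc (p k)) (hQ k)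
  refine exists_bilevel_of_cnf (p := p) (fun x => ?_) h𝒟
  obtain ⟨i, hi⟩ := mem_iUnion.1 (hU.symm ▸ mem_univ x)
  exact ⟨i, hfp i x hi⟩
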